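/- Let Ā₁, Ā₂ : ℝ → ℝ and define the operator S̄ by (S̄ f)(x) = Ā₁(x) f′(x) + Ā₂(x) f(x) on differentiable functions. Then S̄ maps, for every n ≥ 0, every polynomial function of degree n to a polynomial function of degree at most n+1 if and only if Ā₁ is a polynomial function of degree at most 2 and Ā₂ is a polynomial function of degree at most 1, i.e. Ā₁(x) = a₁₀ + a₁₁x + a₁₂x² and Ā₂(x) = a₂₀ + a₂₁x for some reals a₁₀, a₁₁, a₁₂, a₂₀, a₂₁. In particular the space of such operators S̄ is 5-dimensional. -/

import Mathlib

open Polynomial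

/-- The candidate differential S-Heun operator `S̄ = Ā₁ d/dx + Ā₂` on the real line. -/
noncomputable def SbarOp (A₁ A₂ : ℝ → ℝ) (f : ℝ → ℝ) : ℝ → ℝ :=
  fun x => A₁ x * deriv f x + A₂ x * f x

/-- `S̄` maps every polynomial function of degree `n` to a polynomial function of
degree at most `n+1`, for every `n ≥ 0`. -/
def SbarRaise (A₁ A₂ : ℝ → ℝ) : Prop :=
  ∀ (n : ℕ) (p : ℝ[X]), p.degree = (n : WithBot ℕ) →
    ∃ r : ℝ[X], r.degree ≤ (n : WithBot ℕ) + 1 ∧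
      ∀ x : ℝ, SbarOp A₁ A₂ (fun t => p.eval t) x = r.eval x

theorem raise_fwd (A₁ A₂ : ℝ → ℝ) (h : SbarRaise A₁ A₂) :
    ((∃ s : ℝ[X], s.degree ≤ (2 : ℕ) ∧ ∀ x : ℝ, A₁ x = s.eval x) ∧
       (∃ t : ℝ[X], t.degree ≤ (1 : ℕ) ∧ ∀ x : ℝ, A₂ x = t.eval x)) := by
  obtain ⟨t, ht, ht'⟩ := h 0 1 (by simp)
  obtain ⟨r, hr, hr'⟩ := h 1 X (by simp)
  have ht1 : t.degree ≤ (1 : ℕ) := by simpa using ht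
  have hr1 : r.degree ≤ (2 : ℕ) := by
    refine hr.trans (le_of_eq ?_)
    norm_num
  have hA2 : ∀ x, A₂ x = t.eval x := by
    intro x
    have := ht' x
    simpa [SbarOp] using this
  refine ⟨⟨r - X * t, ?_, ?_⟩, t, ht1, hA2⟩
  · rw [← natDegree_le_iff_degree_le] at *
    refine (natDegree_sub_le _ _).trans (max_le hr1 ?_)
    refine natDegree_mul_le.trans ?_
    simp
    omega
  · intro x
    have := hr' x
    simp [SbarOp, hA2] at this
    simp
    linarith

theorem raise_bwd (A₁ A₂ : ℝ → ℝ)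
    (h : ∃ a₁₀ a₁₁ a₁₂ a₂₀ a₂₁ : ℝ, ∀ x : ℝ,
        A₁ x = a₁₀ + a₁₁ * x + a₁₂ * x^2 ∧ A₂ x = a₂₀ + a₂₁ * x) : SbarRaise A₁ A₂ := by
  obtain ⟨a, b, c, d, e, h⟩ := h
  intro n p hp
  refine ⟨(C a + C b * X + C c * X ^ 2) * derivative p + (C d + C e * X) * p, ?_, ?_⟩
  · have hn : p.natDegree = n := natDegree_eq_of_degree_eq_some hp
    have h2 : (C a + C b * X + C c * X ^ 2).natDegree ≤ 2 := by compute_degree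
    have h1 : (C d + C e * X).natDegree ≤ 1 := by compute_degree
    have key : ((C a + C b * X + C c * X ^ 2) * derivative p
        + (C d + C e * X) * p).natDegree ≤ n + 1 := by
      refine (natDegree_add_le _ _).trans (max_le ?_ ?_)
      · rcases Nat.eq_zero_or_pos n with h0 | h0
        · have : derivative p = 0 := by
            rw [h0] at hn
            exact derivative_of_natDegree_zero hn
          simp [this]
        · have := natDegree_derivative_le p
          refine natDegree_mul_le.trans ?_
          omega
      · refine natDegree_mul_le.trans ?_
        omega
    have := natDegree_le_iff_degree_le.1 key
    simpa using this
  · intro x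
    simp [SbarOp, (h x).1, (h x).2]

theorem coeff_form (A₁ A₂ : ℝ → ℝ)
    (h : ((∃ s : ℝ[X], s.degree ≤ (2 : ℕ) ∧ ∀ x : ℝ, A₁ x = s.eval x) ∧
       (∃ t : ℝ[X], t.degree ≤ (1 : ℕ) ∧ ∀ x : ℝ, A₂ x = t.eval x))) :
    ∃ a₁₀ a₁₁ a₁₂ a₂₀ a₂₁ : ℝ, ∀ x : ℝ,
        A₁ x = a₁₀ + a₁₁ * x + a₁₂ * x^2 ∧ A₂ x = a₂₀ + a₂₁ * x := by
  obtain ⟨⟨s, hs, hs'⟩, t, ht, ht'⟩ := h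
  rw [← natDegree_le_iff_degree_le] at hs ht
  refine ⟨s.coeff 0, s.coeff 1, s.coeff 2, t.coeff 0, t.coeff 1, fun x => ⟨?_, ?_⟩⟩
  · rw [hs', eval_eq_sum_range' (Nat.lt_succ_of_le hs)]
    simp [Finset.sum_range_succ]
  · rw [ht', eval_eq_sum_range' (Nat.lt_succ_of_le ht)]
    simp [Finset.sum_range_succ]

theorem raise_iff (A₁ A₂ : ℝ → ℝ) : SbarRaise A₁ A₂ ↔
      ∃ a₁₀ a₁₁ a₁₂ a₂₀ a₂₁ : ℝ, ∀ x : ℝ,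
        A₁ x = a₁₀ + a₁₁ * x + a₁₂ * x^2 ∧ A₂ x = a₂₀ + a₂₁ * x :=
  ⟨fun h => coeff_form _ _ (raise_fwd _ _ h), raise_bwd _ _⟩

def paramMap : (Fin 5 → ℝ) →ₗ[ℝ] (ℝ → ℝ) × (ℝ → ℝ) where
  toFun v := (fun x => v 0 + v 1 * x + v 2 * x ^ 2, fun x => v 3 + v 4 * x)
  map_add' u v := by
    ext x <;> simp <;> ring
  map_smul' c v := by
    ext x <;> simp <;> ring

theorem paramMap_inj : Function.Injective paramMap := by
  rw [← LinearMap.ker_eq_bot, LinearMap.ker_eq_bot']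
  intro v hv
  have h1 : ∀ x : ℝ, v 0 + v 1 * x + v 2 * x ^ 2 = 0 := fun x => congrFun (congrArg Prod.fst hv) x
  have h2 : ∀ x : ℝ, v 3 + v 4 * x = 0 := fun x => congrFun (congrArg Prod.snd hv) x
  have a := h1 0
  have b := h1 1
  have c := h1 (-1)
  have d := h2 0
  have e := h2 1
  norm_num at a b c d e
  ext i
  fin_cases i <;> simp <;> linarith

theorem raise_set : {P : (ℝ → ℝ) × (ℝ → ℝ) | SbarRaise P.1 P.2} =
    (LinearMap.range paramMap : Set ((ℝ → ℝ) × (ℝ → ℝ))) := by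
  ext ⟨A, B⟩
  simp only [Set.mem_setOf_eq, raise_iff, SetLike.mem_coe, LinearMap.mem_range]
  constructor
  · rintro ⟨a, b, c, d, e, h⟩
    refine ⟨![a, b, c, d, e], ?_⟩
    ext x
    · exact (h x).1.symm
    · exact (h x).2.symm
  · rintro ⟨v, hv⟩
    refine ⟨v 0, v 1, v 2, v 3, v 4, fun x => ⟨?_, ?_⟩⟩
    · exact (congrFun (congrArg Prod.fst hv) x).symm
    · exact (congrFun (congrArg Prod.snd hv) x).symm

theorem stmt_2 (A₁ A₂ : ℝ → ℝ) :
    (SbarRaise A₁ A₂ ↔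
      ((∃ s : ℝ[X], s.degree ≤ (2 : ℕ) ∧ ∀ x : ℝ, A₁ x = s.eval x) ∧
       (∃ t : ℝ[X], t.degree ≤ (1 : ℕ) ∧ ∀ x : ℝ, A₂ x = t.eval x))) ∧
    (SbarRaise A₁ A₂ ↔
      ∃ a₁₀ a₁₁ a₁₂ a₂₀ a₂₁ : ℝ, ∀ x : ℝ,
        A₁ x = a₁₀ + a₁₁ * x + a₁₂ * x^2 ∧ A₂ x = a₂₀ + a₂₁ * x) ∧
    Module.finrank ℝ
      ↥(Submodule.span ℝ {P : (ℝ → ℝ) × (ℝ → ℝ) | SbarRaise P.1 P.2}) = 5 := by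
  refine ⟨⟨raise_fwd _ _, fun h => raise_bwd _ _ (coeff_form _ _ h)⟩, raise_iff _ _, ?_⟩
  rw [raise_set, Submodule.span_eq, LinearMap.finrank_range_of_inj paramMap_inj]
  simp
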